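/- Let v⋆ be the heteroclinic solution, η the correction with L⋆η = (1/2)tv⋆', and c⋆ = ∫(v⋆')². Then ∫_{-∞}^{∞} W'''(v⋆(t)) η(t) (v⋆'(t))² dt = c⋆/4. -/

import Mathlib

open MeasureTheory

/-- The two-sided exponential `t ↦ exp (-a|t|)` is integrable for `a > 0`. -/
lemma integrable_exp_neg_mul_abs {a : ℝ} (ha : 0 < a) :
    Integrable (fun t : ℝ ↦ Real.exp (-a * |t|)) := by
  rw [← integrableOn_univ, ← Set.Iic_union_Ioi (a := (0 : ℝ))]
  refine IntegrableOn.union ?_ ?_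
  · refine (integrableOn_exp_mul_Iic ha 0).congr_fun (fun t ht ↦ ?_) measurableSet_Iic
    simp [abs_of_nonpos (Set.mem_Iic.1 ht)]
  · refine (integrableOn_exp_mul_Ioi (neg_lt_zero.2 ha) 0).congr_fun (fun t ht ↦ ?_)
      measurableSet_Ioi
    simp [abs_of_pos (Set.mem_Ioi.1 ht)]

/-- A continuous function with exponential decay is integrable. -/
lemma integrable_of_abs_le_exp {f : ℝ → ℝ} {C a : ℝ} (hf : Continuous f) (ha : 0 < a)
    (h : ∀ t, |f t| ≤ C * Real.exp (-a * |t|)) : Integrable f :=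
  ((integrable_exp_neg_mul_abs ha).const_mul C).mono' hf.aestronglyMeasurable (.of_forall h)

/-- A product of continuous real functions, one bounded and the other integrable, is integrable. -/
lemma integrable_mul_of_abs_le {f g : ℝ → ℝ} {K : ℝ} (hf : Continuous f) (hK : ∀ t, |f t| ≤ K)
    (hg : Integrable g) : Integrable (fun t ↦ f t * g t) :=
  hg.bdd_mul hf.aestronglyMeasurable (.of_forall hK)

/-- A differentiable function with integrable derivative is bounded. -/
lemma exists_abs_le_of_integrable_deriv {f : ℝ → ℝ} (hf : Differentiable ℝ f)
    (hi : Integrable (deriv f)) : ∃ K, ∀ t, |f t| ≤ K := by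
  refine ⟨|f 0| + ∫ t, ‖deriv f t‖, fun t ↦ ?_⟩
  have h := intervalIntegral.integral_deriv_eq_sub (a := 0) (b := t)
    (fun x _ ↦ hf x) hi.intervalIntegrable
  have hb : |f t - f 0| ≤ ∫ t, ‖deriv f t‖ := by
    rw [← h, ← Real.norm_eq_abs]
    exact intervalIntegral.norm_integral_le_integral_norm_uIoc.trans
      (setIntegral_le_integral hi.norm (.of_forall fun _ ↦ norm_nonneg _))
  calc |f t| = |f 0 + (f t - f 0)| := by ring_nf
    _ ≤ |f 0| + |f t - f 0| := abs_add_le _ _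
    _ ≤ _ := by gcongr

/-- The pointwise identity behind `integral_Wppp_eta`: writing `L f = -f'' + W''(v) f`, the function
`W'''(v) η (v')² - (v')² / 4` is an exact derivative when `L η = t v' / 2`. -/
lemma hasDerivAt_wronskian_add
    {W v η : ℝ → ℝ} (hW : ContDiff ℝ (⊤ : ℕ∞) W) (hv : ContDiff ℝ (⊤ : ℕ∞) v)
    (hη : ContDiff ℝ (⊤ : ℕ∞) η)
    (hODE : ∀ t, -(deriv (deriv v) t) + deriv W (v t) = 0)
    (hLη : ∀ t, -(deriv (deriv η) t) + deriv (deriv W) (v t) * η t = (1 / 2) * (t * deriv v t))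
    (t : ℝ) :
    HasDerivAt
      (fun s ↦ deriv v s * deriv (deriv η) s - deriv (deriv v) s * deriv η s
        + s * deriv v s * deriv v s / 4)
      (deriv (deriv (deriv W)) (v t) * η t * deriv v t ^ 2 - deriv v t ^ 2 / 4) t := by
  have smooth {f : ℝ → ℝ} (hf : ContDiff ℝ (⊤ : ℕ∞) f) :
      ContDiff ℝ (⊤ : ℕ∞) (deriv f) ∧ ∀ s, HasDerivAt f (deriv f s) s :=
    ⟨(contDiff_infty_iff_deriv.1 hf).2, fun s ↦ (hf.differentiable (by simp) s).hasDerivAt⟩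
  obtain ⟨hW1, -⟩ := smooth hW
  obtain ⟨hW2, dW1⟩ := smooth hW1
  obtain ⟨-, dW2⟩ := smooth hW2
  obtain ⟨hv1, dv⟩ := smooth hv
  obtain ⟨-, dv1⟩ := smooth hv1
  obtain ⟨hη1, dη⟩ := smooth hη
  obtain ⟨-, dη1⟩ := smooth hη1
  have ev : deriv (deriv v) = fun s ↦ deriv W (v s) := funext fun s ↦ by linarith [hODE s]
  have eη : deriv (deriv η) = fun s ↦ deriv (deriv W) (v s) * η s - (1 / 2) * (s * deriv v s) :=
    funext fun s ↦ by linarith [hLη s]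
  have dv2 : HasDerivAt (deriv (deriv v)) (deriv (deriv W) (v t) * deriv v t) t := by
    rw [ev]
    exact (dW1 (v t)).comp t (dv t)
  have dη2 : HasDerivAt (deriv (deriv η))
      (deriv (deriv (deriv W)) (v t) * deriv v t * η t + deriv (deriv W) (v t) * deriv η t
        - (1 / 2) * (1 * deriv v t + t * deriv (deriv v) t)) t := by
    rw [eη]
    exact (((dW2 (v t)).comp t (dv t)).mul (dη t)).sub
      (((hasDerivAt_id t).mul (dv1 t)).const_mul (1 / 2))
  refine ((((dv1 t).mul dη2).sub (dv2.mul (dη1 t))).add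
    ((((hasDerivAt_id t).mul (dv1 t)).mul (dv1 t)).div_const 4)).congr_deriv ?_
  simp only [id, Pi.mul_apply]
  ring

/-- With `v⋆` the heteroclinic, `η` the correction solving
`L⋆ η = (1/2) t v⋆'`, and `c⋆ = ∫ (v⋆')²`, one has
`∫ W'''(v⋆) η (v⋆')² dt = c⋆ / 4`. -/
theorem integral_Wppp_eta
    (W : ℝ → ℝ) (hW : ContDiff ℝ (⊤ : ℕ∞) W) (hWeven : ∀ t, W (-t) = W t)
    (v : ℝ → ℝ) (hv : ContDiff ℝ (⊤ : ℕ∞) v) (hvodd : ∀ t, v (-t) = -v t)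
    (hODE : ∀ t, -(deriv (deriv v) t) + deriv W (v t) = 0)
    (η : ℝ → ℝ) (hηreg : ContDiff ℝ (⊤ : ℕ∞) η) (hηodd : ∀ t, η (-t) = -η t)
    (hη : ∀ t, -(deriv (deriv η) t) + deriv (deriv W) (v t) * η t = (1 / 2) * (t * deriv v t))
    (hdecay : ∃ C > (0:ℝ), ∃ a > (0:ℝ), ∀ t : ℝ,
      |η t| ≤ C * Real.exp (-a * |t|) ∧
      |deriv η t| ≤ C * Real.exp (-a * |t|) ∧
      |deriv (deriv η) t| ≤ C * Real.exp (-a * |t|) ∧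
      |deriv v t| ≤ C * Real.exp (-a * |t|) ∧
      |deriv (deriv v) t| ≤ C * Real.exp (-a * |t|)) :
    ∫ t : ℝ, deriv (deriv (deriv W)) (v t) * η t * (deriv v t) ^ 2
      = (∫ t : ℝ, (deriv v t) ^ 2) / 4 := by
  obtain ⟨C, hC, a, ha, hd⟩ := hdecay
  have hv1 := (contDiff_infty_iff_deriv.1 hv).2
  have hv2 := (contDiff_infty_iff_deriv.1 hv1).2
  have hη1 := (contDiff_infty_iff_deriv.1 hηreg).2
  have hη2 := (contDiff_infty_iff_deriv.1 hη1).2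
  have hW3 : Continuous (deriv (deriv (deriv W))) :=
    (ContDiff.iterate_deriv 3 hW).continuous
  have iv1 : Integrable (deriv v) :=
    integrable_of_abs_le_exp hv1.continuous ha fun t ↦ (hd t).2.2.2.1
  have iη1 : Integrable (deriv η) :=
    integrable_of_abs_le_exp hη1.continuous ha fun t ↦ (hd t).2.1
  have exp_le (t : ℝ) : C * Real.exp (-a * |t|) ≤ C :=
    mul_le_of_le_one_right hC.le (Real.exp_le_one_iff.2 (by nlinarith [abs_nonneg t]))
  have bη (t : ℝ) : |η t| ≤ C := (hd t).1.trans (exp_le t)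
  have bη2 (t : ℝ) : |deriv (deriv η) t| ≤ C := (hd t).2.2.1.trans (exp_le t)
  have bv1 (t : ℝ) : |deriv v t| ≤ C := (hd t).2.2.2.1.trans (exp_le t)
  have bv2 (t : ℝ) : |deriv (deriv v) t| ≤ C := (hd t).2.2.2.2.trans (exp_le t)
  have btv1 (t : ℝ) : |t * deriv v t| ≤ C / a := by
    have h : a * |t| * Real.exp (-a * |t|) ≤ 1 := by
      rw [neg_mul, Real.exp_neg, ← div_eq_mul_inv, div_le_one (Real.exp_pos _)]
      linarith [Real.add_one_le_exp (a * |t|)]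
    rw [abs_mul, le_div_iff₀ ha]
    calc |t| * |deriv v t| * a ≤ |t| * (C * Real.exp (-a * |t|)) * a := by
          gcongr
          exact (hd t).2.2.2.1
      _ = C * (a * |t| * Real.exp (-a * |t|)) := by ring
      _ ≤ C := mul_le_of_le_one_right hC.le h
  obtain ⟨K, hK⟩ := exists_abs_le_of_integrable_deriv (hv.differentiable (by simp)) iv1
  obtain ⟨M, hM⟩ := (isCompact_Icc (a := -K) (b := K)).exists_bound_of_continuousOn
    hW3.continuousOn
  have isq : Integrable (fun t ↦ deriv v t ^ 2) := by
    simpa only [sq] using integrable_mul_of_abs_le hv1.continuous bv1 iv1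
  have iW : Integrable (fun t ↦ deriv (deriv (deriv W)) (v t) * η t * deriv v t ^ 2) := by
    refine integrable_mul_of_abs_le (K := M * C)
      ((hW3.comp hv.continuous).mul hηreg.continuous) (fun t ↦ ?_) isq
    have hMt := hM (v t) (abs_le.1 (hK t))
    rw [abs_mul]
    exact mul_le_mul hMt (bη t) (abs_nonneg _) ((norm_nonneg _).trans hMt)
  have iF : Integrable (fun s ↦ deriv v s * deriv (deriv η) s - deriv (deriv v) s * deriv η s
      + s * deriv v s * deriv v s / 4) :=
    ((iv1.mul_bdd hη2.continuous.aestronglyMeasurable (.of_forall bη2)).sub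
      (integrable_mul_of_abs_le hv2.continuous bv2 iη1)).add
      ((integrable_mul_of_abs_le (continuous_id.mul hv1.continuous) btv1 iv1).div_const 4)
  have h := integral_eq_zero_of_hasDerivAt_of_integrable
    (hasDerivAt_wronskian_add hW hv hηreg hODE hη) (iW.sub (isq.div_const 4)) iF
  rw [integral_sub iW (isq.div_const 4), integral_div] at h
  exact sub_eq_zero.1 h
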